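/- arXiv:2503.19409 — 2 statements merged into one kernel-verified Lean document; each statement's English description precedes it below -/
import Mathlib

section
/- Let N ≥ 1, μ ∈ (0,1), c₀ > 0 and M ≥ 0. Let U ⊆ ℝ^N be measurable and let φ : ℝ^N → ℝ^N be injective on U, Lipschitz on U with constant M, and have at every x ∈ U a derivative Dφ(x) within U with |det Dφ(x)| ≥ c₀. Then for every measurable F : ℝ^N → ℝ one has ∬_{U×U} |F(φ(x))−F(φ(y))|²/‖x−y‖^{N+2μ} dx dy ≤ c₀^{−2}·M^{N+2μ} · ∬_{φ(U)×φ(U)} |F(x̃)−F(ỹ)|²/‖x̃−ỹ‖^{N+2μ} dx̃ dỹ, where both sides are Lebesgue integrals with values in [0,∞]. -/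
open MeasureTheory

/-- If `|det Dφ| ≥ c` on `U`, then integrals of `g ∘ φ` over `U` are bounded by `c⁻¹` times
integrals of `g` over `φ '' U`; no measurability of `g` is needed. -/
theorem setLIntegral_comp_le_of_le_abs_det {E : Type*} [NormedAddCommGroup E] [NormedSpace ℝ E]
    [FiniteDimensional ℝ E] [MeasurableSpace E] [BorelSpace E] (ν : Measure E)
    [ν.IsAddHaarMeasure] {c : ℝ} (hc : 0 < c) {U : Set E} (hU : MeasurableSet U)
    {φ : E → E} (hinj : Set.InjOn φ U) {φ' : E → E →L[ℝ] E}
    (hφ' : ∀ x ∈ U, HasFDerivWithinAt φ (φ' x) U x) (hdet : ∀ x ∈ U, c ≤ |(φ' x).det|)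
    (g : E → ENNReal) :
    ∫⁻ x in U, g (φ x) ∂ν ≤ ENNReal.ofReal c⁻¹ * ∫⁻ x in φ '' U, g x ∂ν := by
  rw [lintegral_image_eq_lintegral_abs_det_fderiv_mul ν hU hφ' hinj,
    ← lintegral_const_mul' _ _ ENNReal.ofReal_ne_top]
  refine setLIntegral_mono' hU fun x hx => ?_
  rw [← mul_assoc, ← ENNReal.ofReal_mul (inv_nonneg.2 hc.le)]
  refine le_mul_of_one_le_left' ?_
  rw [ENNReal.one_le_ofReal, inv_mul_eq_div, one_le_div hc]
  exact hdet x hx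

/-- Comparison of Gagliardo difference quotients under a map that expands the distance of two
given points at most by the factor `M`. -/
theorem sq_sub_div_rpow_le {E G : Type*} [NormedAddCommGroup E] [NormedAddCommGroup G]
    {M s : ℝ} (hM : 0 ≤ M) (hs : 0 ≤ s) {x y : E} {a b : G} (hab : a = b → x = y)
    (hba : x = y → a = b) (hle : ‖a - b‖ ≤ M * ‖x - y‖) (F : G → ℝ) :
    (F a - F b) ^ 2 / ‖x - y‖ ^ s ≤ M ^ s * ((F a - F b) ^ 2 / ‖a - b‖ ^ s) := by
  by_cases h : x = y
  · simp [hba h]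
  have hxy : 0 < ‖x - y‖ := norm_pos_iff.2 (sub_ne_zero.2 h)
  have hpos : 0 < ‖a - b‖ := norm_pos_iff.2 (sub_ne_zero.2 (mt hab h))
  rw [← mul_div_assoc, div_le_div_iff₀ (by positivity) (by positivity)]
  calc (F a - F b) ^ 2 * ‖a - b‖ ^ s
      ≤ (F a - F b) ^ 2 * (M * ‖x - y‖) ^ s := by gcongr
    _ = M ^ s * (F a - F b) ^ 2 * ‖x - y‖ ^ s := by
        rw [Real.mul_rpow hM hxy.le]; ring

/-- The Gagliardo seminorm of `F ∘ φ` on `U` is controlled by that of `F` on `φ(U)`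
for a bi-Lipschitz change of variables with Jacobian determinant bounded below:
`[F∘φ]²_{W^{μ,2}(U)} ≤ c₀⁻² M^{N+2μ} [F]²_{W^{μ,2}(φ(U))}`. -/
theorem stmt_9 (N : ℕ) (hN : 1 ≤ N) (μ c₀ M : ℝ)
    (hμ : μ ∈ Set.Ioo (0 : ℝ) 1) (hc : 0 < c₀) (hM : 0 ≤ M)
    (U : Set (EuclideanSpace ℝ (Fin N))) (hU : MeasurableSet U)
    (φ : EuclideanSpace ℝ (Fin N) → EuclideanSpace ℝ (Fin N))
    (hinj : Set.InjOn φ U)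
    (hlip : ∀ x ∈ U, ∀ y ∈ U, ‖φ x - φ y‖ ≤ M * ‖x - y‖)
    (φ' : EuclideanSpace ℝ (Fin N) →
      EuclideanSpace ℝ (Fin N) →L[ℝ] EuclideanSpace ℝ (Fin N))
    (hφ' : ∀ x ∈ U, HasFDerivWithinAt φ (φ' x) U x)
    (hdet : ∀ x ∈ U, c₀ ≤ |(φ' x).det|)
    (F : EuclideanSpace ℝ (Fin N) → ℝ) (hF : Measurable F) :
    ∫⁻ x in U, ∫⁻ y in U,
        ENNReal.ofReal ((F (φ x) - F (φ y)) ^ 2 / ‖x - y‖ ^ ((N : ℝ) + 2 * μ)) ≤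
      ENNReal.ofReal ((c₀ ^ 2)⁻¹ * M ^ ((N : ℝ) + 2 * μ)) *
        ∫⁻ x in φ '' U, ∫⁻ y in φ '' U,
          ENNReal.ofReal ((F x - F y) ^ 2 / ‖x - y‖ ^ ((N : ℝ) + 2 * μ)) := by
  have hs : 0 ≤ (N : ℝ) + 2 * μ := by have := hμ.1; positivity
  set s : ℝ := (N : ℝ) + 2 * μ
  let k : EuclideanSpace ℝ (Fin N) → EuclideanSpace ℝ (Fin N) → ENNReal :=
    fun a b => ENNReal.ofReal ((F a - F b) ^ 2 / ‖a - b‖ ^ s)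
  have hchange := setLIntegral_comp_le_of_le_abs_det volume hc hU hinj hφ' hdet
  calc ∫⁻ x in U, ∫⁻ y in U, ENNReal.ofReal ((F (φ x) - F (φ y)) ^ 2 / ‖x - y‖ ^ s)
      ≤ ∫⁻ x in U, ∫⁻ y in U, ENNReal.ofReal (M ^ s) * k (φ x) (φ y) := by
        refine setLIntegral_mono' hU fun x hx => setLIntegral_mono' hU fun y hy => ?_
        rw [← ENNReal.ofReal_mul (by positivity)]
        exact ENNReal.ofReal_le_ofReal (sq_sub_div_rpow_le hM hs (hinj hx hy)
          (congrArg φ) (hlip x hx y hy) F)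
    _ = ENNReal.ofReal (M ^ s) * ∫⁻ x in U, ∫⁻ y in U, k (φ x) (φ y) := by
        simp_rw [lintegral_const_mul' _ _ ENNReal.ofReal_ne_top]
    _ ≤ ENNReal.ofReal (M ^ s) *
          ∫⁻ x in U, ENNReal.ofReal c₀⁻¹ * ∫⁻ y in φ '' U, k (φ x) y := by
        gcongr with x
        exact hchange (k (φ x))
    _ ≤ ENNReal.ofReal (M ^ s) * (ENNReal.ofReal c₀⁻¹ *
          (ENNReal.ofReal c₀⁻¹ * ∫⁻ x in φ '' U, ∫⁻ y in φ '' U, k x y)) := by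
        rw [lintegral_const_mul' _ _ ENNReal.ofReal_ne_top]
        gcongr
        exact hchange fun x => ∫⁻ y in φ '' U, k x y
    _ = ENNReal.ofReal ((c₀ ^ 2)⁻¹ * M ^ s) * ∫⁻ x in φ '' U, ∫⁻ y in φ '' U, k x y := by
        rw [← mul_assoc, ← mul_assoc, ← ENNReal.ofReal_mul (by positivity),
          ← ENNReal.ofReal_mul (by positivity)]
        congr 2
        ring
end

section
/- Let d ≥ 1, q ∈ (1,∞) and μ ∈ (0,1), and set N = d+1. Then the function (x,z) ∈ ℝ^d × ℝ ↦ |z|^q / ((1+|z|^q)·(‖x‖² + z²)^{(N+qμ)/2}) is Lebesgue integrable on ℝ^d × ℝ. -/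
open MeasureTheory

/-- Homogeneity: scaling `x` by `z⁻¹` pulls a power of `|z|` out of the kernel. -/
lemma rpow_norm_sq_add_sq_eq_abs_rpow_mul {E : Type*} [NormedAddCommGroup E] [NormedSpace ℝ E]
    (r : ℝ) {z : ℝ} (hz : z ≠ 0) (x : E) :
    (‖x‖ ^ 2 + z ^ 2) ^ (-r / 2) = |z| ^ (-r) * (1 + ‖z⁻¹ • x‖ ^ 2) ^ (-r / 2) := by
  have hsq : ‖x‖ ^ 2 + z ^ 2 = |z| ^ (2 : ℝ) * (1 + ‖z⁻¹ • x‖ ^ 2) := by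
    rw [Real.rpow_two, norm_smul, norm_inv, Real.norm_eq_abs, mul_pow, inv_pow, sq_abs]
    field_simp
    ring
  rw [hsq, Real.mul_rpow (by positivity) (by positivity), ← Real.rpow_mul (abs_nonneg z)]
  congr 2
  ring

section Haar

variable {E : Type*} [NormedAddCommGroup E] [NormedSpace ℝ E] [MeasurableSpace E] [BorelSpace E]
  [FiniteDimensional ℝ E] (ν : Measure E) [ν.IsAddHaarMeasure]

lemma integrable_rpow_norm_sq_add_sq {r : ℝ} (hr : (Module.finrank ℝ E : ℝ) < r)
    {z : ℝ} (hz : z ≠ 0) :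
    Integrable (fun x : E => (‖x‖ ^ 2 + z ^ 2) ^ (-r / 2)) ν := by
  simp_rw [rpow_norm_sq_add_sq_eq_abs_rpow_mul r hz]
  exact ((integrable_rpow_neg_one_add_norm_sq hr).comp_smul (inv_ne_zero hz)).const_mul _

lemma integral_rpow_norm_sq_add_sq (r : ℝ) {z : ℝ} (hz : z ≠ 0) :
    ∫ x : E, (‖x‖ ^ 2 + z ^ 2) ^ (-r / 2) ∂ν =
      |z| ^ ((Module.finrank ℝ E : ℝ) - r) * ∫ x : E, (1 + ‖x‖ ^ 2) ^ (-r / 2) ∂ν := by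
  simp_rw [rpow_norm_sq_add_sq_eq_abs_rpow_mul r hz]
  rw [integral_const_mul,
    Measure.integral_comp_smul ν (fun x : E => (1 + ‖x‖ ^ 2) ^ (-r / 2)), smul_eq_mul,
    ← mul_assoc, inv_pow, inv_inv, abs_pow, ← Real.rpow_natCast,
    ← Real.rpow_add (abs_pos.2 hz), neg_add_eq_sub]

end Haar

lemma integrable_abs_rpow_div_one_add_mul {q s : ℝ} (hs : s < -1) (hqs : -1 < q + s) :
    Integrable (fun z : ℝ => |z| ^ q / (1 + |z| ^ q) * |z| ^ s) := by
  have key : IntegrableOn (fun z : ℝ => z ^ q / (1 + z ^ q) * z ^ s) (Set.Ioi 0) := by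
    have hmeas : Measurable (fun z : ℝ => z ^ q / (1 + z ^ q) * z ^ s) := by fun_prop
    rw [← Set.Ioc_union_Ioi_eq_Ioi zero_le_one]
    refine IntegrableOn.union ?_ ?_
    · have hint : IntegrableOn (fun z : ℝ => z ^ (q + s)) (Set.Ioc 0 1) :=
        (intervalIntegrable_iff_integrableOn_Ioc_of_le zero_le_one).1
          (intervalIntegral.intervalIntegrable_rpow' hqs)
      refine hint.mono' hmeas.aestronglyMeasurable ?_
      filter_upwards [ae_restrict_mem measurableSet_Ioc] with z hz
      have hzq := Real.rpow_nonneg hz.1.le q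
      have hzs := Real.rpow_nonneg hz.1.le s
      rw [Real.norm_of_nonneg (by positivity), Real.rpow_add hz.1]
      gcongr
      exact div_le_self hzq (by linarith)
    · refine (integrableOn_Ioi_rpow_of_lt hs zero_lt_one).mono' hmeas.aestronglyMeasurable ?_
      filter_upwards [ae_restrict_mem measurableSet_Ioi] with z hz
      have hz0 : 0 < z := zero_lt_one.trans hz
      have hzq := Real.rpow_nonneg hz0.le q
      have hzs := Real.rpow_nonneg hz0.le s
      rw [Real.norm_of_nonneg (by positivity)]
      exact mul_le_of_le_one_left hzs (div_le_one_of_le₀ (by linarith) (by positivity))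
  have := (integrable_fun_norm_addHaar (volume : Measure ℝ)
    (f := fun z : ℝ => z ^ q / (1 + z ^ q) * z ^ s)).2 (by simpa using key)
  simpa only [Real.norm_eq_abs] using this

/-- Integrability on `ℝ^d × ℝ` of
`(x,z) ↦ |z|^q / ((1+|z|^q)(‖x‖²+z²)^{(N+qμ)/2})` with `N = d+1`. -/
theorem stmt_12 (d : ℕ) (hd : 1 ≤ d) (q μ : ℝ) (hq : 1 < q)
    (hμ : μ ∈ Set.Ioo (0 : ℝ) 1) :
    Integrable (fun P : EuclideanSpace ℝ (Fin d) × ℝ =>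
      |P.2| ^ q /
        ((1 + |P.2| ^ q) * (‖P.1‖ ^ 2 + P.2 ^ 2) ^ (((d : ℝ) + 1 + q * μ) / 2))) := by
  obtain ⟨hμ0, hμ1⟩ := hμ
  set r : ℝ := (d : ℝ) + 1 + q * μ with hr
  have hqμ : 0 < q * μ := by positivity
  have hsplit : ∀ (x : EuclideanSpace ℝ (Fin d)) (z : ℝ),
      |z| ^ q / ((1 + |z| ^ q) * (‖x‖ ^ 2 + z ^ 2) ^ (r / 2)) =
        |z| ^ q / (1 + |z| ^ q) * (‖x‖ ^ 2 + z ^ 2) ^ (-r / 2) := fun x z => by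
    rw [neg_div, Real.rpow_neg (by positivity), div_mul_eq_div_div, div_eq_mul_inv _ (_ ^ (r / 2))]
  have hne : ∀ᵐ z : ℝ, z ≠ 0 := Measure.ae_ne volume 0
  simp_rw [hsplit]
  refine (integrable_prod_iff' (Measurable.aestronglyMeasurable (by fun_prop))).2 ⟨?_, ?_⟩
  · filter_upwards [hne] with z hz
    refine (integrable_rpow_norm_sq_add_sq volume ?_ hz).const_mul _
    rw [finrank_euclideanSpace_fin]
    linarith
  · have hz_int : Integrable (fun z : ℝ => |z| ^ q / (1 + |z| ^ q) * |z| ^ ((d : ℝ) - r)) :=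
      integrable_abs_rpow_div_one_add_mul (by linarith) (by nlinarith)
    refine (hz_int.mul_const
      (∫ x : EuclideanSpace ℝ (Fin d), (1 + ‖x‖ ^ 2) ^ (-r / 2))).congr ?_
    filter_upwards [hne] with z hz
    have hnorm : ∀ x : EuclideanSpace ℝ (Fin d),
        ‖|z| ^ q / (1 + |z| ^ q) * (‖x‖ ^ 2 + z ^ 2) ^ (-r / 2)‖ =
          |z| ^ q / (1 + |z| ^ q) * (‖x‖ ^ 2 + z ^ 2) ^ (-r / 2) := fun x =>
      Real.norm_of_nonneg (by positivity)
    simp_rw [hnorm]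
    rw [integral_const_mul, integral_rpow_norm_sq_add_sq volume r hz, finrank_euclideanSpace_fin,
      mul_assoc]
end
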